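/- arXiv:2507.04071 — 2 statements merged into one kernel-verified Lean document; each statement's English description precedes it below -/
import Mathlib

section
/- For any terms F, P, R, S and variable x, {(F : πxPR), (S : P)} ⊨ (βFS : R[S/x]), where πxPR abbreviates ρλxPR. -/
namespace Paper

/-- Terms of the bare bones dependent type system (Part 1): constants `c n`,
variables `v n`, dependent products `ρR`, applications `βRS` and abstractions `λxRS`. -/
inductive Tm : Type
  | const : ℕ → Tm
  | var : ℕ → Tm
  | rho : Tm → Tm
  | app : Tm → Tm → Tm
  | lam : ℕ → Tm → Tm → Tm
  deriving DecidableEq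

namespace Tm

/-- The size of a term. -/
def size : Tm → ℕ
  | const _ => 1
  | var _ => 1
  | rho R => R.size + 1
  | app R S => R.size + S.size + 1
  | lam _ R S => R.size + S.size + 1

/-- The free variables `F(T)` of a term. -/
def fv : Tm → Finset ℕ
  | const _ => ∅
  | var x => {x}
  | rho R => R.fv
  | app R S => R.fv ∪ S.fv
  | lam x R S => R.fv ∪ (S.fv \ {x})

/-- The bound variables `B(T)` of a term. -/
def bv : Tm → Finset ℕ
  | const _ => ∅
  | var _ => ∅
  | rho R => R.bv
  | app R S => R.bv ∪ S.bv
  | lam x R S => (R.bv ∪ S.bv) ∪ {x}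

/-- All variables `V(T) = F(T) ∪ B(T)` occurring in a term. -/
def vars (t : Tm) : Finset ℕ := t.fv ∪ t.bv

/-- A fixed choice of a variable outside a given finite set of variables. -/
def fresh (s : Finset ℕ) : ℕ := s.sup id + 1

theorem fresh_not_mem (s : Finset ℕ) : fresh s ∉ s := by
  intro h
  have := Finset.le_sup (f := id) h
  simp only [id] at this
  simp only [fresh] at this
  omega

/-- Capture-avoiding renaming `S[z/y]` (substitution of the variable `z` for the
variable `y`), implemented with a fuel parameter and carrying the fact that it
preserves the size of the term. -/
def renameAux : (n : ℕ) → (S : Tm) → S.size ≤ n → (z y : ℕ) → {t : Tm // t.size = S.size}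
  | _, const a, _, _, _ => ⟨const a, rfl⟩
  | _, var v, _, z, y => if v = y then ⟨var z, rfl⟩ else ⟨var v, rfl⟩
  | 0, rho _, h, _, _ => absurd h (by simp only [size]; omega)
  | n + 1, rho R, h, z, y =>
      let R' := renameAux n R (by simp only [size] at h; omega) z y
      ⟨rho R'.1, by simp only [size, R'.2]⟩
  | 0, app _ _, h, _, _ => absurd h (by simp only [size]; omega)
  | n + 1, app R S, h, z, y =>
      let R' := renameAux n R (by simp only [size] at h; omega) z y
      let S' := renameAux n S (by simp only [size] at h; omega) z y
      ⟨app R'.1 S'.1, by simp only [size, R'.2, S'.2]⟩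
  | 0, lam _ _ _, h, _, _ => absurd h (by simp only [size]; omega)
  | n + 1, lam w R S, h, z, y =>
      let R' := renameAux n R (by simp only [size] at h; omega) z y
      if w = y ∨ y ∉ S.fv then
        ⟨lam w R'.1 S, by simp only [size, R'.2]⟩
      else if w ≠ z then
        -- here `w ∉ F(z)`, so the chosen fresh variable is `w` itself
        let S' := renameAux n S (by simp only [size] at h; omega) z y
        ⟨lam w R'.1 S'.1, by simp only [size, R'.2, S'.2]⟩
      else
        let z' := fresh ((var z).vars ∪ S.vars)
        let S₁ := renameAux n S (by simp only [size] at h; omega) z' w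
        let S₂ := renameAux n S₁.1 (by rw [S₁.2]; simp only [size] at h; omega) z y
        ⟨lam z' R'.1 S₂.1, by simp only [size, S₂.2, S₁.2, R'.2]⟩

/-- Capture-avoiding renaming `S[z/y]` of the variable `y` to the variable `z`. -/
def rename (S : Tm) (z y : ℕ) : Tm := (renameAux S.size S le_rfl z y).1

theorem size_rename (S : Tm) (z y : ℕ) : (rename S z y).size = S.size :=
  (renameAux S.size S le_rfl z y).2

/-- Capture-avoiding substitution `S[T/x]` of the term `T` for the variable `x` in `S`,
renaming bound variables (using the fixed choice `fresh`) to avoid capture. -/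
def subst : Tm → Tm → ℕ → Tm
  | const a, _, _ => const a
  | var v, T, x => if v = x then T else var v
  | rho R, T, x => rho (subst R T x)
  | app R S, T, x => app (subst R T x) (subst S T x)
  | lam w R S, T, x =>
      if w = x ∨ x ∉ S.fv then lam w (subst R T x) S
      else if w ∉ T.fv then lam w (subst R T x) (subst S T x)
      else lam (fresh (T.vars ∪ S.vars)) (subst R T x)
        (subst (rename S (fresh (T.vars ∪ S.vars)) w) T x)
termination_by S _ _ => S.size
decreasing_by all_goals (simp only [size, size_rename]; omega)

end Tm

end Paper
namespace Paper

open ZFSet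

/-- The application `R(s) = ⋃ R{s} = ⋃ {r | ⟨r,s⟩ ∈ R}` of a set to a set
(ordered pairs `⟨r,s⟩` are Kuratowski pairs `ZFSet.pair r s`). -/
noncomputable def sApp (R s : ZFSet.{0}) : ZFSet :=
  ⋃₀ (ZFSet.sep (fun r => ZFSet.pair r s ∈ R) (⋃₀ (⋃₀ R)))

/-- The domain `dom(S) = {d | ∃ r, ⟨r,d⟩ ∈ S}` of a set. -/
noncomputable def sDom (S : ZFSet.{0}) : ZFSet :=
  ZFSet.sep (fun d => ∃ r, ZFSet.pair r d ∈ S) (⋃₀ (⋃₀ S))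

/-- The range `ran(S) = {r | ∃ d, ⟨r,d⟩ ∈ S}` of a set. -/
noncomputable def sRan (S : ZFSet.{0}) : ZFSet :=
  ZFSet.sep (fun r => ∃ d, ZFSet.pair r d ∈ S) (⋃₀ (⋃₀ S))

/-- `F` is a function: a set of ordered pairs `⟨value, argument⟩` which, for each
`d` in its domain, contains a unique pair with second component `d`. -/
def IsFun (F : ZFSet.{0}) : Prop :=
  (∀ p ∈ F, ∃ r d, p = ZFSet.pair r d) ∧
    ∀ d r r', ZFSet.pair r d ∈ F → ZFSet.pair r' d ∈ F → r = r'

/-- The dependent product `∏F`: the set of all functions `f` with `dom f = dom F`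
such that `f(d) ∈ F(d)` for every `d ∈ dom F` (with the paper's convention that
functions are sets of pairs `⟨value, argument⟩`). -/
noncomputable def dprod (F : ZFSet.{0}) : ZFSet :=
  ZFSet.sep
    (fun f => IsFun f ∧ sDom f = sDom F ∧ ∀ d ∈ sDom F, sApp f d ∈ sApp F d)
    (ZFSet.powerset (ZFSet.prod (⋃₀ (sRan F)) (sDom F)))

/-- The set `{⟨f r, r⟩ : r ∈ X}`, i.e. the graph (in the paper's convention) of the
function sending each `r ∈ X` to `f r`. -/
noncomputable def lamSet (X : ZFSet.{0}) (f : ZFSet.{0} → ZFSet.{0}) : ZFSet :=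
  @ZFSet.image (fun r => ZFSet.pair (f r) r) (Classical.allZFSetDefinable _) X

/-- An assignment of sets to the constants and the variables. -/
structure Asn where
  c : ℕ → ZFSet.{0}
  v : ℕ → ZFSet.{0}

/-- The assignment modified to send the variable `x` to the set `s`. -/
noncomputable def Asn.update (A : Asn) (x : ℕ) (s : ZFSet.{0}) : Asn :=
  ⟨A.c, Function.update A.v x s⟩

/-- The interpretation `⟦·⟧` of terms determined by an assignment:
`⟦ρS⟧ = ∏⟦S⟧`, `⟦βRS⟧ = ⟦R⟧(⟦S⟧)` and `⟦λxRS⟧ = {⟨⟦S⟧_{⟨r,x⟩}, r⟩ : r ∈ ⟦R⟧}`. -/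
noncomputable def interp : Tm → Asn → ZFSet
  | Tm.const a, A => A.c a
  | Tm.var x, A => A.v x
  | Tm.rho R, A => dprod (interp R A)
  | Tm.app R S, A => sApp (interp R A) (interp S A)
  | Tm.lam x R S, A => lamSet (interp R A) (fun r => interp S (A.update x r))

end Paper
namespace Paper

/-- The head α-conversion relation
`≡^α = {⟨λxRS, λyR(S[y/x])⟩ : x ∉ B(S) and y ∉ V(S)}`. -/
def HeadAlpha (A B : Tm) : Prop :=
  ∃ (x y : ℕ) (R S : Tm), x ∉ S.bv ∧ y ∉ S.vars ∧
    A = Tm.lam x R S ∧ B = Tm.lam y R (S.subst (Tm.var y) x)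

end Paper
namespace Paper

/-- The contextual closure of a relation on terms: the smallest relation
containing it such that `R ▷ C` implies `βSR ▷ βSC`, `βRS ▷ βCS`, `λxSR ▷ λxSC`,
`λxRS ▷ λxCS` and `ρR ▷ ρC`. -/
inductive Ctx (r : Tm → Tm → Prop) : Tm → Tm → Prop
  | base {R C : Tm} : r R C → Ctx r R C
  | appLeft {R C S : Tm} : Ctx r R C → Ctx r (Tm.app R S) (Tm.app C S)
  | appRight {R C S : Tm} : Ctx r R C → Ctx r (Tm.app S R) (Tm.app S C)
  | lamDom {R C S : Tm} {x : ℕ} : Ctx r R C → Ctx r (Tm.lam x R S) (Tm.lam x C S)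
  | lamBody {R C S : Tm} {x : ℕ} : Ctx r R C → Ctx r (Tm.lam x S R) (Tm.lam x S C)
  | rho {R C : Tm} : Ctx r R C → Ctx r (Tm.rho R) (Tm.rho C)

/-- α-conversion `≡_α`: the reflexive transitive contextual closure of
head α-conversion. -/
def AlphaEq : Tm → Tm → Prop := Relation.ReflTransGen (Ctx HeadAlpha)

end Paper
namespace Paper

/-- The setoid of α-conversion: the equivalence relation generated by the
contextual closure of head α-conversion (which coincides with `AlphaEq`). -/
def alphaSetoid : Setoid Tm := Relation.EqvGen.setoid (Ctx HeadAlpha)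

/-- α-equivalence classes of terms. -/
def QTm := Quotient alphaSetoid

/-- The α-equivalence class `[T]_α` of a term. -/
def cls (t : Tm) : QTm := Quotient.mk alphaSetoid t

/-- Typing statements `(S : P)`: pairs of α-equivalence classes of terms. -/
abbrev Stmt := QTm × QTm

/-- The free variables of an α-equivalence class, i.e. the union of the free
variables of its representatives (free variables are α-invariant). -/
def Fq (q : QTm) : Set ℕ := {v | ∃ T : Tm, cls T = q ∧ v ∈ T.fv}

/-- The free variables `F(Γ)` of a set of typing statements: the union of the
free variables of the subjects and predicates of its statements. -/
def FSet (Γ : Set Stmt) : Set ℕ := {v | ∃ st ∈ Γ, v ∈ Fq st.1 ∨ v ∈ Fq st.2}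

/-- The product term `πxRS := ρλxRS`. -/
def Tm.pi (x : ℕ) (R S : Tm) : Tm := Tm.rho (Tm.lam x R S)

end Paper
namespace Paper

/-- An interpretation satisfies the typing statement `(S : P)` iff `⟦S⟧ ∈ ⟦P⟧`
(this is independent of the choice of representatives, interpretations being
α-invariant). -/
def QSat (A : Asn) (st : Stmt) : Prop :=
  ∀ S P : Tm, st.1 = cls S → st.2 = cls P → interp S A ∈ interp P A

/-- An interpretation is a model for `Γ` iff it satisfies every statement in `Γ`. -/
def QModels (A : Asn) (Γ : Set Stmt) : Prop := ∀ st ∈ Γ, QSat A st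

/-- The consequence relation `Γ ⊨ X`: every model of `Γ` is a model of `X`. -/
def QConseq (Γ : Set Stmt) (st : Stmt) : Prop :=
  ∀ A : Asn, QModels A Γ → QSat A st

/-- `Γ ⊨ Δ` iff `Γ ⊨ X` for every `X ∈ Δ`. -/
def QConseqSet (Γ Δ : Set Stmt) : Prop := ∀ st ∈ Δ, QConseq Γ st

end Paper

namespace Paper

theorem interp_congr (t : Tm) : ∀ {A B : Asn}, A.c = B.c → (∀ v ∈ t.fv, A.v v = B.v v) →
    interp t A = interp t B := by
  induction t with
  | const a => intro A B hc _; simp [interp, hc]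
  | var v => intro A B _ hv; simpa [interp, Tm.fv] using hv
  | rho R ih => intro A B hc hv; simp only [interp]; rw [ih hc hv]
  | app R S ihR ihS =>
    intro A B hc hv
    simp only [Tm.fv, Finset.mem_union] at hv
    simp only [interp]
    rw [ihR hc fun v h => hv v (.inl h), ihS hc fun v h => hv v (.inr h)]
  | lam x R S ihR ihS =>
    intro A B hc hv
    simp only [Tm.fv, Finset.mem_union, Finset.mem_sdiff, Finset.mem_singleton] at hv
    simp only [interp]
    rw [ihR hc fun v h => hv v (.inl h)]
    congr 1
    funext r
    refine ihS hc fun v h => ?_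
    by_cases hx : v = x
    · simp [Asn.update, hx]
    · simp [Asn.update, hx, hv v (.inr ⟨h, hx⟩)]

theorem interp_lam_congr {A B : Asn} {w w' : ℕ} {R R' S S' : Tm}
    (hR : interp R A = interp R' B)
    (hS : ∀ r, interp S (A.update w r) = interp S' (B.update w' r)) :
    interp (Tm.lam w R S) A = interp (Tm.lam w' R' S') B := by
  simp only [interp, hR]
  congr 1
  exact funext hS

theorem interp_renameAux (n : ℕ) : ∀ (S : Tm) (h : S.size ≤ n) (z y : ℕ) (A : Asn),
    interp (Tm.renameAux n S h z y).1 A = interp S (A.update y (A.v z)) := by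
  induction n with
  | zero => intro S h; cases S <;> simp [Tm.size] at h
  | succ n ih =>
    intro S h z y A
    cases S with
    | const a => simp [Tm.renameAux, interp, Asn.update]
    | var v =>
      by_cases hv : v = y <;> simp [Tm.renameAux, interp, Asn.update, hv]
    | rho R => simp [Tm.renameAux, interp, ih]
    | app R S => simp [Tm.renameAux, interp, ih]
    | lam w R S =>
      simp only [Tm.renameAux]
      split_ifs with h1 h2
      · refine interp_lam_congr (ih ..) fun r => interp_congr _ rfl fun v hv => ?_
        simp only [Asn.update, Function.update_apply]
        grind
      · refine interp_lam_congr (ih ..) fun r => ?_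
        rw [ih]
        refine interp_congr _ rfl fun v hv => ?_
        simp only [Asn.update, Function.update_apply]
        grind
      · have hz := Tm.fresh_not_mem ((Tm.var z).vars ∪ S.vars)
        set z' := Tm.fresh ((Tm.var z).vars ∪ S.vars)
        simp only [Tm.vars, Tm.fv, Tm.bv, Finset.mem_union, Finset.mem_singleton] at hz
        refine interp_lam_congr (ih ..) fun r => ?_
        rw [ih, ih]
        refine interp_congr _ rfl fun v hv => ?_
        simp only [Asn.update, Function.update_apply]
        grind

theorem interp_rename (S : Tm) (z y : ℕ) (A : Asn) :
    interp (S.rename z y) A = interp S (A.update y (A.v z)) :=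
  interp_renameAux ..

/-- Substitution corresponds to modifying the assignment. -/
theorem interp_subst (S T : Tm) (x : ℕ) (A : Asn) :
    interp (S.subst T x) A = interp S (A.update x (interp T A)) := by
  induction hn : S.size using Nat.strong_induction_on generalizing S A with
  | _ n ih =>
    subst hn
    cases S with
    | const a => simp [Tm.subst, interp, Asn.update]
    | var v =>
      by_cases hv : v = x <;> simp [Tm.subst, interp, Asn.update, hv]
    | rho R =>
      rw [Tm.subst, interp, interp, ih R.size (by simp [Tm.size]) R A rfl]
    | app R S =>
      rw [Tm.subst, interp, interp, ih R.size (by simp only [Tm.size]; omega) R A rfl,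
        ih S.size (by simp only [Tm.size]; omega) S A rfl]
    | lam w R S =>
      have hR := ih R.size (by simp only [Tm.size]; omega) R A rfl
      have hT : ∀ (u : ℕ) (r : ZFSet), u ∉ T.fv → interp T (A.update u r) = interp T A := by
        intro u r hu
        refine interp_congr _ rfl fun v hv => ?_
        simp only [Asn.update, Function.update_apply]
        grind
      rw [Tm.subst]
      split_ifs with h1 h2
      · refine interp_lam_congr hR fun r => interp_congr _ rfl fun v hv => ?_
        simp only [Asn.update, Function.update_apply]
        grind
      · have hz := Tm.fresh_not_mem (T.vars ∪ S.vars)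
        set z := Tm.fresh (T.vars ∪ S.vars)
        simp only [Tm.vars, Finset.mem_union] at hz
        refine interp_lam_congr hR fun r => ?_
        rw [ih _ (by rw [Tm.size_rename]; simp only [Tm.size]; omega) (S.rename z w) _ rfl,
          interp_rename, hT z r (by grind)]
        refine interp_congr _ rfl fun v hv => ?_
        simp only [Asn.update, Function.update_apply]
        grind
      · refine interp_lam_congr hR fun r => ?_
        rw [ih S.size (by simp only [Tm.size]; omega) S _ rfl, hT w r h2]
        refine interp_congr _ rfl fun v hv => ?_
        simp only [Asn.update, Function.update_apply]
        grind

theorem HeadAlpha.interp_eq {R C : Tm} (h : HeadAlpha R C) (A : Asn) :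
    interp R A = interp C A := by
  obtain ⟨x, y, R, S, -, hy, rfl, rfl⟩ := h
  refine interp_lam_congr rfl fun r => ?_
  rw [interp_subst]
  refine interp_congr _ rfl fun v hv => ?_
  simp only [Tm.vars, Finset.mem_union] at hy
  simp only [interp, Asn.update, Function.update_apply]
  grind

theorem Ctx.interp_eq {R C : Tm} (h : Ctx HeadAlpha R C) :
    ∀ A : Asn, interp R A = interp C A := by
  induction h with
  | base h => exact h.interp_eq
  | appLeft _ ih => intro A; rw [interp, interp, ih]
  | appRight _ ih => intro A; rw [interp, interp, ih]
  | lamDom _ ih => exact fun A => interp_lam_congr (ih A) fun _ => rfl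
  | lamBody _ ih => exact fun A => interp_lam_congr rfl fun _ => ih _
  | rho _ ih => intro A; rw [interp, interp, ih]

/-- Interpretations are α-invariant. -/
theorem interp_eq_of_cls_eq {R C : Tm} (h : cls R = cls C) (A : Asn) :
    interp R A = interp C A := by
  replace h : Relation.EqvGen (Ctx HeadAlpha) R C := Quotient.exact h
  induction h with
  | rel _ _ h => exact h.interp_eq A
  | refl => rfl
  | symm _ _ _ ih => exact ih.symm
  | trans _ _ _ _ _ ih₁ ih₂ => exact ih₁.trans ih₂

theorem qSat_cls (A : Asn) (S P : Tm) : QSat A (cls S, cls P) ↔ interp S A ∈ interp P A := by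
  refine ⟨fun h => h S P rfl rfl, fun h S' P' hS hP => ?_⟩
  rwa [← interp_eq_of_cls_eq hS, ← interp_eq_of_cls_eq hP]

theorem mem_lamSet {X p : ZFSet.{0}} {f : ZFSet.{0} → ZFSet.{0}} :
    p ∈ lamSet X f ↔ ∃ r ∈ X, ZFSet.pair (f r) r = p := by
  let := Classical.allZFSetDefinable fun v : Fin 1 → ZFSet.{0} => ZFSet.pair (f (v 0)) (v 0)
  exact ZFSet.mem_image

theorem pair_mem_lamSet {X r s : ZFSet.{0}} {f : ZFSet.{0} → ZFSet.{0}} :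
    ZFSet.pair r s ∈ lamSet X f ↔ s ∈ X ∧ r = f s := by
  rw [mem_lamSet]
  constructor
  · rintro ⟨t, ht, h⟩
    obtain ⟨rfl, rfl⟩ := ZFSet.pair_injective h
    exact ⟨ht, rfl⟩
  · rintro ⟨hs, rfl⟩
    exact ⟨s, hs, rfl⟩

theorem mem_sUnion_sUnion_of_pair_mem {R r s : ZFSet.{0}} (h : ZFSet.pair r s ∈ R) :
    r ∈ R.sUnion.sUnion ∧ s ∈ R.sUnion.sUnion := by
  have hp : ({r, s} : ZFSet) ∈ R.sUnion :=
    ZFSet.mem_sUnion.2 ⟨_, h, by simp [ZFSet.pair]⟩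
  exact ⟨ZFSet.mem_sUnion.2 ⟨_, hp, by simp⟩, ZFSet.mem_sUnion.2 ⟨_, hp, by simp⟩⟩

theorem mem_sDom {R d : ZFSet.{0}} : d ∈ sDom R ↔ ∃ r, ZFSet.pair r d ∈ R := by
  rw [sDom, ZFSet.mem_sep]
  exact ⟨And.right, fun h => ⟨(mem_sUnion_sUnion_of_pair_mem h.choose_spec).2, h⟩⟩

theorem mem_sApp {R s a : ZFSet.{0}} : a ∈ sApp R s ↔ ∃ r, ZFSet.pair r s ∈ R ∧ a ∈ r := by
  rw [sApp, ZFSet.mem_sUnion]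
  constructor
  · rintro ⟨r, hr, ha⟩
    exact ⟨r, (ZFSet.mem_sep.1 hr).2, ha⟩
  · rintro ⟨r, hr, ha⟩
    exact ⟨r, ZFSet.mem_sep.2 ⟨(mem_sUnion_sUnion_of_pair_mem hr).1, hr⟩, ha⟩

theorem sApp_lamSet {X s : ZFSet.{0}} (f : ZFSet.{0} → ZFSet.{0}) (hs : s ∈ X) :
    sApp (lamSet X f) s = f s := by
  ext a
  simp [mem_sApp, pair_mem_lamSet, hs]

theorem sDom_lamSet (X : ZFSet.{0}) (f : ZFSet.{0} → ZFSet.{0}) : sDom (lamSet X f) = X := by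
  ext a
  simp [mem_sDom, pair_mem_lamSet]

/-- `{(F : πxPR), (S : P)} ⊨ (βFS : R[S/x])`. -/
theorem conseq_app (F P R S : Tm) (x : ℕ) :
    QConseq {(cls F, cls (Tm.pi x P R)), (cls S, cls P)}
      (cls (Tm.app F S), cls (R.subst S x)) := by
  intro A hA
  have hF := (qSat_cls ..).1 (hA _ (.inl rfl))
  have hS := (qSat_cls ..).1 (hA _ (.inr rfl))
  rw [qSat_cls, interp_subst, interp]
  rw [Tm.pi, interp, interp, dprod, ZFSet.mem_sep] at hF
  have h := hF.2.2.2 (interp S A) (by rwa [sDom_lamSet])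
  rwa [sApp_lamSet _ hS] at h

end Paper
end

section
/- For all m, n ∈ ω, sets of typing statements Γ, Δ and terms S, P: if Γ ⊢_m Δ (i.e. Γ ⊢_m X for every X ∈ Δ) and Δ ⊢_n (S:P), then Γ ⊢_{m+n} (S:P). In other words ⊢_m ∘ ⊢_n ⊆ ⊢_{m+n}. -/
namespace Paper

/-- One step of the stratification: `Step prev` is the smallest monotone
reflexive relation satisfying (App) and (Ab) with premises taken from `prev`. -/
inductive Step (prev : Set Stmt → Stmt → Prop) : Set Stmt → Stmt → Prop
  | mem {Γ : Set Stmt} {st : Stmt} : st ∈ Γ → Step prev Γ st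
  | mono {Γ Δ : Set Stmt} {st : Stmt} : Δ ⊆ Γ → Step prev Δ st → Step prev Γ st
  | app {Γ : Set Stmt} (F S P R : Tm) (x : ℕ) :
      prev Γ (cls F, cls (Tm.pi x P R)) → prev Γ (cls S, cls P) →
      Step prev Γ (cls (Tm.app F S), cls (R.subst S x))
  | ab {Γ : Set Stmt} (Q S P : Tm) (y : ℕ) :
      y ∉ FSet Γ → y ∉ Q.fv →
      prev (Γ ∪ {(cls (Tm.var y), cls Q)}) (cls S, cls P) →
      Step prev Γ (cls (Tm.lam y Q S), cls (Tm.pi y Q P))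

/-- The stratified inference relations `⊢_n`: `⊢_0` is the smallest monotone
reflexive relation (i.e. membership) and `⊢_{n+1} = Step ⊢_n`. -/
def DeriveN : ℕ → Set Stmt → Stmt → Prop
  | 0 => fun Γ st => st ∈ Γ
  | n + 1 => Step (DeriveN n)

end Paper

namespace Paper

/-- Locally nameless terms, used as canonical representatives of α-equivalence classes. -/
inductive LN : Type
  | const : ℕ → LN
  | bvar : ℕ → LN
  | fvar : ℕ → LN
  | rho : LN → LN
  | app : LN → LN → LN
  | lam : LN → LN → LN

namespace LN

/-- The size of a locally nameless term. -/
def size : LN → ℕ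
  | const _ => 1
  | bvar _ => 1
  | fvar _ => 1
  | rho a => a.size + 1
  | app a b => a.size + b.size + 1
  | lam a b => a.size + b.size + 1

/-- The free variables of a locally nameless term. -/
def fv : LN → Finset ℕ
  | const _ => ∅
  | bvar _ => ∅
  | fvar v => {v}
  | rho a => a.fv
  | app a b => a.fv ∪ b.fv
  | lam a b => a.fv ∪ b.fv

/-- Replace the free variable `x` by the index `k`, counted from the root of the term. -/
def close (x : ℕ) : ℕ → LN → LN
  | _, const a => const a
  | _, bvar j => bvar j
  | k, fvar v => if v = x then bvar k else fvar v
  | k, rho a => rho (close x k a)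
  | k, app a b => app (close x k a) (close x k b)
  | k, lam a b => lam (close x k a) (close x (k + 1) b)

/-- Replace the index `k`, counted from the root of the term, by the free variable `x`. -/
def instantiate (x : ℕ) : ℕ → LN → LN
  | _, const a => const a
  | k, bvar j => if j = k then fvar x else bvar j
  | _, fvar v => fvar v
  | k, rho a => rho (instantiate x k a)
  | k, app a b => app (instantiate x k a) (instantiate x k b)
  | k, lam a b => lam (instantiate x k a) (instantiate x (k + 1) b)

/-- Substitution of `t` for the free variable `x`. -/
def subst : LN → LN → ℕ → LN
  | const a, _, _ => const a
  | bvar j, _, _ => bvar j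
  | fvar v, t, x => if v = x then t else fvar v
  | rho a, t, x => rho (subst a t x)
  | app a b, t, x => app (subst a t x) (subst b t x)
  | lam a b, t, x => lam (subst a t x) (subst b t x)

/-- All dangling indices are below `k`. -/
def ClosedAt : ℕ → LN → Prop
  | _, const _ => True
  | k, bvar j => j < k
  | _, fvar _ => True
  | k, rho a => ClosedAt k a
  | k, app a b => ClosedAt k a ∧ ClosedAt k b
  | k, lam a b => ClosedAt k a ∧ ClosedAt (k + 1) b

/-- The action of a permutation of the variables. -/
def perm (π : Equiv.Perm ℕ) : LN → LN
  | const a => const a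
  | bvar j => bvar j
  | fvar v => fvar (π v)
  | rho a => rho (perm π a)
  | app a b => app (perm π a) (perm π b)
  | lam a b => lam (perm π a) (perm π b)

theorem size_close (x k : ℕ) (d : LN) : (close x k d).size = d.size := by
  induction d generalizing k <;> simp_all [close, size]
  split <;> rfl

theorem size_subst_fvar (f x : ℕ) (d : LN) : (subst d (fvar f) x).size = d.size := by
  induction d <;> simp_all [subst, size]
  split <;> rfl

theorem fv_close (x k : ℕ) (d : LN) : (close x k d).fv = d.fv \ {x} := by
  induction d generalizing k <;> simp_all [close, fv, Finset.union_sdiff_distrib]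
  split <;> simp_all [fv, Finset.sdiff_singleton_eq_erase, Ne.symm]

theorem close_of_notMem_fv {x : ℕ} (k : ℕ) {d : LN} (h : x ∉ d.fv) : close x k d = d := by
  induction d generalizing k <;> simp_all [close, fv]
  grind

theorem subst_of_notMem_fv (t : LN) {x : ℕ} {d : LN} (h : x ∉ d.fv) : subst d t x = d := by
  induction d <;> simp_all [subst, fv]
  grind

theorem close_subst {t : LN} {x w : ℕ} (k : ℕ) (d : LN) (hwx : w ≠ x) (hwt : w ∉ t.fv) :
    close w k (subst d t x) = subst (close w k d) t x := by
  induction d generalizing k <;> simp_all [close, subst]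
  rename_i v
  by_cases hv : v = x
  · simp [hv, Ne.symm hwx, close_of_notMem_fv k hwt, subst]
  · by_cases hw : v = w <;> simp [hv, hw, close, subst, hwx]

theorem close_rename {f : ℕ} (w k : ℕ) {d : LN} (hf : f ∉ d.fv) :
    close f k (subst d (fvar f) w) = close w k d := by
  induction d generalizing k <;> simp_all [close, subst, fv]
  split <;> simp [close]
  grind

theorem ClosedAt.close {k : ℕ} (x : ℕ) {d : LN} (h : ClosedAt k d) :
    ClosedAt (k + 1) (LN.close x k d) := by
  induction d generalizing k <;> simp_all [ClosedAt, LN.close]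
  · omega
  · split <;> simp [ClosedAt]

theorem instantiate_close (f x : ℕ) {k : ℕ} {d : LN} (h : ClosedAt k d) :
    instantiate f k (close x k d) = subst d (fvar f) x := by
  induction d generalizing k <;> simp_all [ClosedAt, instantiate, close, subst]
  · omega
  · split <;> simp [instantiate]

theorem perm_eq_self {π : Equiv.Perm ℕ} {d : LN} (h : ∀ v ∈ d.fv, π v = v) : perm π d = d := by
  induction d <;> simp_all [perm, fv]

theorem perm_close (π : Equiv.Perm ℕ) (x k : ℕ) (d : LN) :
    perm π (close x k d) = close (π x) k (perm π d) := by
  induction d generalizing k <;> simp_all [perm, close]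
  split <;> simp [perm]

theorem perm_subst (π : Equiv.Perm ℕ) (t : LN) (x : ℕ) (d : LN) :
    perm π (subst d t x) = subst (perm π d) (perm π t) (π x) := by
  induction d <;> simp_all [perm, subst]
  split <;> simp [perm]

theorem fv_perm (π : Equiv.Perm ℕ) (d : LN) : (perm π d).fv = d.fv.image π := by
  induction d <;> simp_all [perm, fv, Finset.image_union]

end LN

namespace Tm

/-- The locally nameless form of a term. -/
def toLN : Tm → LN
  | const a => .const a
  | var v => .fvar v
  | rho R => .rho R.toLN
  | app R S => .app R.toLN S.toLN
  | lam x R S => .lam R.toLN (S.toLN.close x 0)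

/-- The action of a permutation of the variables, renaming bound variables as well. -/
def perm (π : Equiv.Perm ℕ) : Tm → Tm
  | const a => const a
  | var v => var (π v)
  | rho R => rho (perm π R)
  | app R S => app (perm π R) (perm π S)
  | lam x R S => lam (π x) (perm π R) (perm π S)

theorem fv_toLN (T : Tm) : T.toLN.fv = T.fv := by
  induction T <;> simp_all [toLN, LN.fv, fv, LN.fv_close]

theorem closedAt_toLN (T : Tm) : T.toLN.ClosedAt 0 := by
  induction T <;> simp_all [toLN, LN.ClosedAt, LN.ClosedAt.close]

theorem toLN_perm (π : Equiv.Perm ℕ) (T : Tm) : (T.perm π).toLN = T.toLN.perm π := by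
  induction T <;> simp_all [toLN, perm, LN.perm, LN.perm_close]

theorem subst_close_of_eq_or_notMem {w x : ℕ} {S : Tm} (T : LN) (h : w = x ∨ x ∉ S.fv) :
    (S.toLN.close w 0).subst T x = S.toLN.close w 0 := by
  apply LN.subst_of_notMem_fv
  rw [LN.fv_close, fv_toLN]
  grind

theorem close_subst_rename {f w x : ℕ} {S : Tm} {T : LN} (hx : f ≠ x) (hT : f ∉ T.fv)
    (hS : f ∉ S.fv) :
    ((S.toLN.subst (.fvar f) w).subst T x).close f 0 = (S.toLN.close w 0).subst T x := by
  rw [LN.close_subst _ _ hx hT, LN.close_rename _ _ (by rwa [fv_toLN])]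

theorem fresh_vars_notMem_fv (T S : Tm) :
    fresh (T.vars ∪ S.vars) ∉ T.fv ∧ fresh (T.vars ∪ S.vars) ∉ S.fv := by
  have h := fresh_not_mem (T.vars ∪ S.vars)
  exact ⟨fun hT => h (Finset.mem_union_left _ (Finset.mem_union_left _ hT)),
    fun hS => h (Finset.mem_union_right _ (Finset.mem_union_left _ hS))⟩

theorem toLN_renameAux (n : ℕ) (S : Tm) (h : S.size ≤ n) (z y : ℕ) :
    (renameAux n S h z y).1.toLN = S.toLN.subst (.fvar z) y := by
  induction n generalizing S z y with
  | zero => cases S <;> simp [size] at h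
  | succ n ih =>
    cases S with
    | const a => simp [renameAux, toLN, LN.subst]
    | var v => simp only [renameAux, toLN, LN.subst]; split <;> simp [toLN]
    | rho R => simp [renameAux, toLN, LN.subst, ih]
    | app R S => simp [renameAux, toLN, LN.subst, ih]
    | lam w R S =>
      simp only [renameAux]
      split_ifs with h₁ h₂
      · simp [toLN, LN.subst, ih, subst_close_of_eq_or_notMem _ h₁]
      · simp only [toLN, LN.subst, ih]
        rw [LN.close_subst _ _ (by tauto) (by simpa [LN.fv] using h₂)]
      · obtain ⟨hz, hS⟩ := fresh_vars_notMem_fv (var z) S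
        simp only [toLN, LN.subst, ih]
        rw [not_or, not_not] at h₁
        rw [close_subst_rename (ne_of_mem_of_not_mem h₁.2 hS).symm
          (by simpa [LN.fv, fv] using hz) hS]

theorem toLN_rename (S : Tm) (z y : ℕ) : (S.rename z y).toLN = S.toLN.subst (.fvar z) y :=
  toLN_renameAux _ _ _ _ _

theorem toLN_subst (S T : Tm) (x : ℕ) : (S.subst T x).toLN = S.toLN.subst T.toLN x := by
  induction hn : S.size using Nat.strong_induction_on generalizing S with
  | _ n ih =>
  subst hn
  cases S with
  | const a => simp [subst, toLN, LN.subst]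
  | var v => simp only [subst, toLN, LN.subst]; split <;> simp [toLN]
  | rho R => simp [subst, toLN, LN.subst, ih R.size (by simp [size]) R rfl]
  | app R S =>
    simp [subst, toLN, LN.subst, ih R.size (by simp only [size]; omega) R rfl,
      ih S.size (by simp only [size]; omega) S rfl]
  | lam w R S =>
    have hR := ih R.size (by simp only [size]; omega) R rfl
    rw [subst]
    split_ifs with h₁ h₂
    · simp [toLN, LN.subst, hR, subst_close_of_eq_or_notMem _ h₁]
    · obtain ⟨hT, hS⟩ := fresh_vars_notMem_fv T S
      simp only [toLN, LN.subst, hR]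
      rw [ih S.size (by simp only [size]; omega) _ (size_rename _ _ _), toLN_rename]
      rw [not_or, not_not] at h₁
      rw [close_subst_rename (ne_of_mem_of_not_mem h₁.2 hS).symm (by rwa [fv_toLN]) hS]
    · simp only [toLN, LN.subst, hR, ih S.size (by simp only [size]; omega) S rfl]
      rw [LN.close_subst _ _ (by tauto) (by rwa [fv_toLN])]

theorem bv_subst_var {x y : ℕ} {S : Tm} (hy : y ∉ S.bv) :
    (S.subst (var y) x).bv = S.bv := by
  induction S with
  | const a => simp [subst]
  | var v => rw [subst]; split <;> simp [bv]
  | rho R ih => simp_all [subst, bv]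
  | app R S ihR ihS => simp_all [subst, bv]
  | lam w R S ihR ihS =>
    simp only [bv, Finset.mem_union, Finset.mem_singleton, not_or] at hy
    rw [subst]
    split_ifs with h₁ h₂
    · simp [bv, ihR hy.1.1]
    · exact absurd (Finset.mem_singleton.1 h₂).symm hy.2
    · simp [bv, ihR hy.1.1, ihS hy.1.2]

end Tm

theorem toLN_eq_of_headAlpha {A B : Tm} (h : HeadAlpha A B) : A.toLN = B.toLN := by
  obtain ⟨x, y, R, S, -, hy, rfl, rfl⟩ := h
  simp only [Tm.toLN, Tm.toLN_subst]
  rw [LN.close_rename]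
  rw [Tm.fv_toLN]
  exact fun h => hy (Finset.mem_union_left _ h)

theorem toLN_eq_of_ctx {A B : Tm} (h : Ctx HeadAlpha A B) : A.toLN = B.toLN := by
  induction h with
  | base h => exact toLN_eq_of_headAlpha h
  | _ => simp_all [Tm.toLN]

theorem toLN_eq_of_cls_eq {A B : Tm} (h : cls A = cls B) : A.toLN = B.toLN := by
  replace h : Relation.EqvGen (Ctx HeadAlpha) A B := Quotient.exact h
  induction h with
  | rel _ _ h => exact toLN_eq_of_ctx h
  | refl => rfl
  | symm _ _ _ ih => exact ih.symm
  | trans _ _ _ _ _ ih₁ ih₂ => exact ih₁.trans ih₂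

theorem cls_congr {f : Tm → Tm} (hf : ∀ A B, Ctx HeadAlpha A B → Ctx HeadAlpha (f A) (f B))
    {A B : Tm} (h : cls A = cls B) : cls (f A) = cls (f B) := by
  replace h : Relation.EqvGen (Ctx HeadAlpha) A B := Quotient.exact h
  apply Quotient.sound
  change Relation.EqvGen (Ctx HeadAlpha) (f A) (f B)
  induction h with
  | rel _ _ h => exact .rel _ _ (hf _ _ h)
  | refl => exact .refl _
  | symm _ _ _ ih => exact .symm _ _ ih
  | trans _ _ _ _ _ ih₁ ih₂ => exact .trans _ _ _ ih₁ ih₂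

theorem cls_rho_congr {R R' : Tm} (h : cls R = cls R') : cls (.rho R) = cls (.rho R') :=
  cls_congr (fun _ _ => .rho) h

theorem cls_app_congr {R R' S S' : Tm} (hR : cls R = cls R') (hS : cls S = cls S') :
    cls (.app R S) = cls (.app R' S') :=
  (cls_congr (f := fun R => .app R S) (fun _ _ => .appLeft) hR).trans
    (cls_congr (f := fun S => .app R' S) (fun _ _ => .appRight) hS)

theorem cls_lam_congr (x : ℕ) {R R' S S' : Tm} (hR : cls R = cls R') (hS : cls S = cls S') :
    cls (.lam x R S) = cls (.lam x R' S') :=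
  (cls_congr (f := fun R => .lam x R S) (fun _ _ => .lamDom) hR).trans
    (cls_congr (f := fun S => .lam x R' S) (fun _ _ => .lamBody) hS)

theorem cls_lam_rename {x y : ℕ} (R : Tm) {S : Tm} (hx : x ∉ S.bv) (hy : y ∉ S.vars) :
    cls (.lam x R S) = cls (.lam y R (S.subst (.var y) x)) :=
  Quotient.sound (Relation.EqvGen.rel _ _ (.base ⟨x, y, R, S, hx, hy, rfl, rfl⟩))

theorem exists_cls_eq_notMem_bv (x : ℕ) (S : Tm) : ∃ S', cls S = cls S' ∧ x ∉ S'.bv := by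
  induction S with
  | const a => exact ⟨_, rfl, by simp [Tm.bv]⟩
  | var v => exact ⟨_, rfl, by simp [Tm.bv]⟩
  | rho R ih =>
    obtain ⟨R', hR, hx⟩ := ih
    exact ⟨.rho R', cls_rho_congr hR, hx⟩
  | app R S ihR ihS =>
    obtain ⟨R', hR, hxR⟩ := ihR
    obtain ⟨S', hS, hxS⟩ := ihS
    exact ⟨.app R' S', cls_app_congr hR hS, by simp [Tm.bv, hxR, hxS]⟩
  | lam w R S ihR ihS =>
    obtain ⟨R', hR, hxR⟩ := ihR
    obtain ⟨S', hS, hxS⟩ := ihS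
    by_cases hw : w = x
    · subst hw
      obtain ⟨f, hf⟩ := Infinite.exists_notMem_finset (S'.vars ∪ {w})
      simp only [Finset.mem_union, Finset.mem_singleton, not_or] at hf
      refine ⟨.lam f R' (S'.subst (.var f) w),
        (cls_lam_congr w hR hS).trans (cls_lam_rename R' hxS hf.1), ?_⟩
      rw [Tm.bv, Tm.bv_subst_var (fun h => hf.1 (Finset.mem_union_right _ h))]
      simp [hxR, hxS, Ne.symm hf.2]
    · exact ⟨.lam w R' S', cls_lam_congr w hR hS, by simp [Tm.bv, hxR, hxS, Ne.symm hw]⟩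

theorem cls_eq_of_toLN_eq {A B : Tm} (h : A.toLN = B.toLN) : cls A = cls B := by
  induction hn : A.toLN.size using Nat.strong_induction_on generalizing A B with
  | _ n ih =>
  subst hn
  cases A <;> cases B <;> simp only [Tm.toLN, reduceCtorEq, LN.const.injEq, LN.fvar.injEq,
    LN.rho.injEq, LN.app.injEq, LN.lam.injEq] at h
  · rw [h]
  · rw [h]
  · exact cls_rho_congr (ih _ (by simp [Tm.toLN, LN.size]) h rfl)
  · exact cls_app_congr (ih _ (by simp only [Tm.toLN, LN.size]; omega) h.1 rfl)
      (ih _ (by simp only [Tm.toLN, LN.size]; omega) h.2 rfl)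
  · rename_i x R S y R' S'
    obtain ⟨S₁, hS, hx⟩ := exists_cls_eq_notMem_bv x S
    obtain ⟨S₂, hS', hy⟩ := exists_cls_eq_notMem_bv y S'
    obtain ⟨f, hf⟩ := Infinite.exists_notMem_finset (S₁.vars ∪ S₂.vars)
    simp only [Finset.mem_union, not_or] at hf
    have hR : cls R = cls R' := ih _ (by simp only [Tm.toLN, LN.size]; omega) h.1 rfl
    have hlt : (S₁.subst (.var f) x).toLN.size < (Tm.lam x R S).toLN.size := by
      rw [Tm.toLN_subst, Tm.toLN, LN.size_subst_fvar, ← toLN_eq_of_cls_eq hS]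
      simp only [Tm.toLN, LN.size, LN.size_close]
      omega
    have heq : (S₁.subst (.var f) x).toLN = (S₂.subst (.var f) y).toLN := by
      rw [Tm.toLN_subst, Tm.toLN_subst, Tm.toLN, ← LN.instantiate_close f x S₁.closedAt_toLN,
        ← LN.instantiate_close f y S₂.closedAt_toLN, ← toLN_eq_of_cls_eq hS,
        ← toLN_eq_of_cls_eq hS', h.2]
    rw [cls_lam_congr x rfl hS, cls_lam_congr y rfl hS', cls_lam_rename R hx hf.1,
      cls_lam_rename R' hy hf.2]
    exact cls_lam_congr f hR (ih _ hlt heq rfl)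

theorem Fq_cls (T : Tm) : Fq (cls T) = T.fv := by
  ext v
  constructor
  · rintro ⟨T', h, hv⟩
    rw [← Tm.fv_toLN, toLN_eq_of_cls_eq h, Tm.fv_toLN] at hv
    exact hv
  · exact fun hv => ⟨T, rfl, hv⟩

theorem finite_Fq (q : QTm) : (Fq q).Finite := by
  induction q using Quotient.inductionOn with
  | _ T =>
  exact Fq_cls T ▸ T.fv.finite_toSet

theorem finite_FSet {Γ : Set Stmt} (h : Γ.Finite) : (FSet Γ).Finite := by
  have : FSet Γ = ⋃ st ∈ Γ, Fq st.1 ∪ Fq st.2 := by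
    ext v
    simp [FSet]
  rw [this]
  exact h.biUnion fun st _ => (finite_Fq _).union (finite_Fq _)

theorem FSet_mono {Γ Δ : Set Stmt} (h : Γ ⊆ Δ) : FSet Γ ⊆ FSet Δ :=
  fun _ ⟨st, hst, hv⟩ => ⟨st, h hst, hv⟩

/-- The action of a permutation of the variables on α-equivalence classes. -/
def QTm.perm (π : Equiv.Perm ℕ) : QTm → QTm :=
  Quotient.lift (fun T => cls (T.perm π)) fun _ _ h => cls_eq_of_toLN_eq <| by
    rw [Tm.toLN_perm, Tm.toLN_perm, toLN_eq_of_cls_eq (Quotient.sound h)]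

theorem QTm.perm_cls (π : Equiv.Perm ℕ) (T : Tm) : (cls T).perm π = cls (T.perm π) := rfl

theorem QTm.perm_eq_self {π : Equiv.Perm ℕ} {q : QTm} (h : ∀ v ∈ Fq q, π v = v) :
    q.perm π = q := by
  induction q using Quotient.inductionOn with
  | _ T =>
  apply cls_eq_of_toLN_eq
  rw [Tm.toLN_perm]
  apply LN.perm_eq_self
  rw [Tm.fv_toLN]
  intro v hv
  exact h v ⟨T, rfl, hv⟩

theorem Fq_perm (π : Equiv.Perm ℕ) (q : QTm) : Fq (q.perm π) = π '' Fq q := by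
  induction q using Quotient.inductionOn with
  | _ T =>
  change Fq (cls (T.perm π)) = π '' Fq (cls T)
  rw [Fq_cls, Fq_cls, ← Tm.fv_toLN, Tm.toLN_perm, LN.fv_perm, Tm.fv_toLN, Finset.coe_image]

theorem cls_perm_subst (π : Equiv.Perm ℕ) (R S : Tm) (x : ℕ) :
    cls ((R.subst S x).perm π) = cls ((R.perm π).subst (S.perm π) (π x)) := by
  apply cls_eq_of_toLN_eq
  simp only [Tm.toLN_perm, Tm.toLN_subst, LN.perm_subst]

theorem cls_lam_swap {y z : ℕ} (Q : Tm) {S : Tm} (hz : z ∉ S.fv) :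
    cls (.lam z Q (S.perm (Equiv.swap y z))) = cls (.lam y Q S) := by
  apply cls_eq_of_toLN_eq
  have h := LN.perm_close (Equiv.swap y z) y 0 S.toLN
  rw [Equiv.swap_apply_left] at h
  rw [Tm.toLN, Tm.toLN, Tm.toLN_perm, ← h, LN.perm_eq_self]
  intro v hv
  rw [LN.fv_close, Tm.fv_toLN] at hv
  exact Equiv.swap_apply_of_ne_of_ne (by grind) (by grind)

/-- The action of a permutation of the variables on typing statements. -/
def Stmt.perm (π : Equiv.Perm ℕ) (st : Stmt) : Stmt := (st.1.perm π, st.2.perm π)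

theorem FSet_image_perm (π : Equiv.Perm ℕ) (Γ : Set Stmt) :
    FSet (Stmt.perm π '' Γ) = π '' FSet Γ := by
  ext v
  constructor
  · rintro ⟨_, ⟨st, hst, rfl⟩, hv⟩
    simp only [Stmt.perm, Fq_perm] at hv
    obtain ⟨u, hu, rfl⟩ | ⟨u, hu, rfl⟩ := hv
    · exact ⟨u, ⟨st, hst, .inl hu⟩, rfl⟩
    · exact ⟨u, ⟨st, hst, .inr hu⟩, rfl⟩
  · rintro ⟨u, ⟨st, hst, hu⟩, rfl⟩
    refine ⟨_, ⟨st, hst, rfl⟩, ?_⟩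
    simp only [Stmt.perm, Fq_perm]
    exact hu.imp (Set.mem_image_of_mem _) (Set.mem_image_of_mem _)

theorem image_perm_eq_self {π : Equiv.Perm ℕ} {Γ : Set Stmt} (h : ∀ v ∈ FSet Γ, π v = v) :
    Stmt.perm π '' Γ = Γ := by
  have hst : ∀ st ∈ Γ, Stmt.perm π st = st := fun st hst => Prod.ext
    (QTm.perm_eq_self fun v hv => h v ⟨st, hst, .inl hv⟩)
    (QTm.perm_eq_self fun v hv => h v ⟨st, hst, .inr hv⟩)
  rw [Set.image_congr hst, Set.image_id']

theorem DeriveN.mem {n : ℕ} {Γ : Set Stmt} {st : Stmt} (h : st ∈ Γ) : DeriveN n Γ st := by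
  cases n with
  | zero => exact h
  | succ n => exact Step.mem h

theorem DeriveN.mono {n : ℕ} {Γ Δ : Set Stmt} {st : Stmt} (hΔ : Δ ⊆ Γ) (h : DeriveN n Δ st) :
    DeriveN n Γ st := by
  cases n with
  | zero => exact hΔ h
  | succ n => exact Step.mono hΔ h

theorem Step.imp {r s : Set Stmt → Stmt → Prop} (hrs : ∀ Γ st, r Γ st → s Γ st)
    {Γ : Set Stmt} {st : Stmt} (h : Step r Γ st) : Step s Γ st := by
  induction h with
  | mem h => exact .mem h
  | mono hΔ _ ih => exact .mono hΔ ih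
  | app F S P R x hF hS => exact .app F S P R x (hrs _ _ hF) (hrs _ _ hS)
  | ab Q S P y hΓ hQ h => exact .ab Q S P y hΓ hQ (hrs _ _ h)

theorem DeriveN.succ {n : ℕ} {Γ : Set Stmt} {st : Stmt} (h : DeriveN n Γ st) :
    DeriveN (n + 1) Γ st := by
  induction n generalizing Γ st with
  | zero => exact Step.mem h
  | succ n ih => exact Step.imp (fun _ _ => ih) h

theorem DeriveN.le {m n : ℕ} (hmn : m ≤ n) {Γ : Set Stmt} {st : Stmt} (h : DeriveN m Γ st) :
    DeriveN n Γ st :=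
  Nat.le_induction h (fun _ _ => DeriveN.succ) n hmn

theorem DeriveN.perm (π : Equiv.Perm ℕ) {n : ℕ} {Γ : Set Stmt} {st : Stmt}
    (h : DeriveN n Γ st) : DeriveN n (Stmt.perm π '' Γ) (st.perm π) := by
  induction n generalizing Γ st with
  | zero => exact Set.mem_image_of_mem _ h
  | succ n ih =>
    change Step (DeriveN n) _ _
    replace h : Step (DeriveN n) Γ st := h
    induction h with
    | mem h => exact .mem (Set.mem_image_of_mem _ h)
    | mono hΔ _ ih' => exact .mono (Set.image_mono hΔ) ih'
    | app F S P R x hF hS =>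
      rw [Stmt.perm, QTm.perm_cls, QTm.perm_cls, cls_perm_subst]
      exact .app _ _ (P.perm π) _ _ (ih hF) (ih hS)
    | ab Q S P y hΓ hQ h =>
      refine .ab (Q.perm π) (S.perm π) (P.perm π) (π y) ?_ ?_ ?_
      · rwa [FSet_image_perm, π.injective.mem_set_image]
      · rwa [← Tm.fv_toLN, Tm.toLN_perm, LN.fv_perm, Tm.fv_toLN, π.injective.mem_finset_image]
      · have := ih h
        rwa [Set.image_union, Set.image_singleton] at this

theorem DeriveN.exists_finite {n : ℕ} {Γ : Set Stmt} {st : Stmt} (h : DeriveN n Γ st) :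
    ∃ Γ₀ ⊆ Γ, Γ₀.Finite ∧ DeriveN n Γ₀ st := by
  induction n generalizing Γ st with
  | zero => exact ⟨{st}, Set.singleton_subset_iff.2 h, Set.finite_singleton _, rfl⟩
  | succ n ih =>
    replace h : Step (DeriveN n) Γ st := h
    induction h with
    | mem h =>
      exact ⟨_, Set.singleton_subset_iff.2 h, Set.finite_singleton _, Step.mem rfl⟩
    | mono hΔ _ ih' =>
      obtain ⟨Γ₀, h₀, hfin, hd⟩ := ih'
      exact ⟨Γ₀, h₀.trans hΔ, hfin, hd⟩
    | app F S P R x hF hS =>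
      obtain ⟨Γ₁, h₁, hfin₁, hd₁⟩ := ih hF
      obtain ⟨Γ₂, h₂, hfin₂, hd₂⟩ := ih hS
      exact ⟨Γ₁ ∪ Γ₂, Set.union_subset h₁ h₂, hfin₁.union hfin₂,
        Step.app F S P R x (hd₁.mono Set.subset_union_left) (hd₂.mono Set.subset_union_right)⟩
    | @ab Γ Q S P y hΓ hQ h =>
      obtain ⟨Γ₁, h₁, hfin₁, hd₁⟩ := ih h
      refine ⟨Γ₁ ∩ Γ, Set.inter_subset_right, hfin₁.inter_of_left _,
        Step.ab Q S P y (fun hy => hΓ (FSet_mono Set.inter_subset_right hy)) hQ (hd₁.mono ?_)⟩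
      intro st hst
      exact (h₁ hst).imp (fun h => ⟨hst, h⟩) id

theorem DeriveN.exists_finite_forall {n : ℕ} {Γ Δ : Set Stmt} (hfin : Δ.Finite)
    (h : ∀ st ∈ Δ, DeriveN n Γ st) :
    ∃ Γ₀ ⊆ Γ, Γ₀.Finite ∧ ∀ st ∈ Δ, DeriveN n Γ₀ st := by
  choose! f hf hffin hd using fun st hst => (h st hst).exists_finite
  exact ⟨⋃ st ∈ Δ, f st, Set.iUnion₂_subset hf, hfin.biUnion hffin,
    fun st hst => (hd st hst).mono (Set.subset_biUnion_of_mem (u := f) hst)⟩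

/-- In rule (Ab), the bound variable may be replaced by any sufficiently fresh one. -/
theorem DeriveN.swap {n : ℕ} {Δ : Set Stmt} {Q S P : Tm} {y z : ℕ} (hyΔ : y ∉ FSet Δ)
    (hyQ : y ∉ Q.fv) (hzΔ : z ∉ FSet Δ) (hzQ : z ∉ Q.fv)
    (h : DeriveN n (Δ ∪ {(cls (.var y), cls Q)}) (cls S, cls P)) :
    DeriveN n (Δ ∪ {(cls (.var z), cls Q)})
      (cls (S.perm (Equiv.swap y z)), cls (P.perm (Equiv.swap y z))) := by
  have h := h.perm (Equiv.swap y z)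
  have hfix {s : Set ℕ} (hy : y ∉ s) (hz : z ∉ s) : ∀ v ∈ s, Equiv.swap y z v = v :=
    fun v hv => Equiv.swap_apply_of_ne_of_ne (fun e => hy (e ▸ hv)) (fun e => hz (e ▸ hv))
  have hQ : (cls Q).perm (Equiv.swap y z) = cls Q :=
    QTm.perm_eq_self (hfix (by simpa [Fq_cls] using hyQ) (by simpa [Fq_cls] using hzQ))
  rwa [Set.image_union, Set.image_singleton, image_perm_eq_self (hfix hyΔ hzΔ), Stmt.perm, hQ,
    QTm.perm_cls, Tm.perm, Equiv.swap_apply_left] at h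

theorem DeriveN.comp {m n : ℕ} {Γ Δ : Set Stmt} {st : Stmt} (h : DeriveN n Δ st)
    (hΔ : ∀ st ∈ Δ, DeriveN m Γ st) : DeriveN (m + n) Γ st := by
  induction n generalizing Γ Δ st with
  | zero => exact hΔ st h
  | succ n ih =>
    replace h : Step (DeriveN n) Δ st := h
    induction h with
    | mem h => exact (hΔ _ h).le (Nat.le_add_right _ _)
    | mono hsub _ ih' => exact ih' fun st hst => hΔ st (hsub hst)
    | app F S P R x hF hS => exact Step.app F S P R x (ih hF hΔ) (ih hS hΔ)
    | @ab Δ Q S P y hyΔ hyQ h =>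
      obtain ⟨Δ₁, hΔ₁, hfin₁, hd⟩ := h.exists_finite
      have hsub : Δ₁ ∩ Δ ⊆ Δ := Set.inter_subset_right
      have hfin : (Δ₁ ∩ Δ).Finite := hfin₁.inter_of_left _
      have hd' : DeriveN n (Δ₁ ∩ Δ ∪ {(cls (.var y), cls Q)}) (cls S, cls P) :=
        hd.mono fun st hst => (hΔ₁ hst).imp (fun h => ⟨hst, h⟩) id
      obtain ⟨Γ₀, hΓ₀, hΓfin, hΓd⟩ :=
        DeriveN.exists_finite_forall hfin fun st hst => hΔ st (hsub hst)
      obtain ⟨z, hz⟩ := (((finite_FSet hΓfin).union (finite_FSet hfin)).union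
        (Q.fv ∪ S.fv ∪ P.fv).finite_toSet).exists_notMem
      simp only [Set.mem_union, Finset.mem_coe, Finset.mem_union, not_or] at hz
      obtain ⟨⟨hzΓ, hzΔ⟩, ⟨hzQ, hzS⟩, hzP⟩ := hz
      have hswap := hd'.swap (fun hy => hyΔ (FSet_mono hsub hy)) hyQ hzΔ hzQ
      have hcomp := ih (Γ := Γ₀ ∪ {(cls (.var z), cls Q)}) hswap fun st hst => hst.elim
        (fun h => (hΓd st h).mono Set.subset_union_left) (fun h => .mem (.inr h))
      have hab : DeriveN (m + (n + 1)) Γ₀ _ := Step.ab Q _ _ z hzΓ hzQ hcomp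
      rw [cls_lam_swap Q hzS, Tm.pi, cls_rho_congr (cls_lam_swap Q hzP)] at hab
      exact hab.mono hΓ₀

/-- `⊢_m ∘ ⊢_n ⊆ ⊢_{m+n}`: if `Γ ⊢_m X` for every `X ∈ Δ` and
`Δ ⊢_n (S : P)`, then `Γ ⊢_{m+n} (S : P)`. -/
theorem deriveN_comp (m n : ℕ) (Γ Δ : Set Stmt) (S P : Tm) :
    (∀ st ∈ Δ, DeriveN m Γ st) → DeriveN n Δ (cls S, cls P) →
      DeriveN (m + n) Γ (cls S, cls P) := by
  exact fun hΔ h => h.comp hΔ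

end Paper
end
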